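/- arXiv:1506.08087 — 3 statements merged into one kernel-verified Lean document; each statement's English description precedes it below -/
import Mathlib

section
/- Suppose c = n+1, let 𝒜 be a homogeneous matrix for the degree data with I_t(𝒜) of codimension c in R, and suppose moreover that the ideal I_{t−1}(𝒜) of (t−1) × (t−1) minors of 𝒜 has codimension ≥ c+1 (equivalently, since dim R = n+1, that I_{t−1}(𝒜) = R; i.e. A := R/I_t(𝒜) is a good determinantal artinian k-algebra). Then I_t(𝒜) is generated by a regular sequence of c = n+1 homogeneous polynomials, i.e. A is a (graded artinian) complete intersection. -/
open MvPolynomial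

noncomputable section

/-- The ideal of `m × m` minors of a matrix with entries in a commutative ring. -/
def minorsIdeal {S : Type} [CommRing S] {p q : ℕ} (m : ℕ)
    (A : Matrix (Fin p) (Fin q) S) : Ideal S :=
  Ideal.span {x | ∃ (f : Fin m → Fin p) (g : Fin m → Fin q),
    StrictMono f ∧ StrictMono g ∧ x = ((A.submatrix f g).det)}

/-- The height (codimension) of an ideal: the infimum of the heights of the primes
containing it. -/
def idealHeight {S : Type} [CommRing S] (I : Ideal S) : ℕ∞ :=
  sInf {h | ∃ p : PrimeSpectrum S, I ≤ p.asIdeal ∧ h = Order.height p}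

/-- A homogeneous matrix for the degree data `(b; a)`:  the `(i,j)` entry is homogeneous of
degree `a j - b i` (in particular it is zero whenever `a j < b i`). -/
def IsHomogMat {S : Type} [CommSemiring S] {n p q : ℕ} (b : Fin p → ℤ) (a : Fin q → ℤ)
    (A : Matrix (Fin p) (Fin q) (MvPolynomial (Fin (n + 1)) S)) : Prop :=
  ∀ i j, (A i j).IsHomogeneous (a j - b i).toNat ∧ (a j - b i < 0 → A i j = 0)

/-- The submatrix consisting of the first `m` columns. -/
def firstCols {S : Type} {p q : ℕ} (A : Matrix (Fin p) (Fin q) S) (m : ℕ) (h : m ≤ q) :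
    Matrix (Fin p) (Fin m) S :=
  A.submatrix id (Fin.castLE h)

end

section

open IsLocalRing RingTheory.Sequence CategoryTheory Abelian Pointwise

/-- If `x` is `M`-regular, every associated prime of `M` lies strictly below an associated prime of
`M ⧸ xM` containing `x`. -/
lemma exists_lt_mem_associatedPrimes_quotSMulTop {R M : Type} [CommRing R] [IsLocalRing R]
    [IsNoetherianRing R] [AddCommGroup M] [Module R M] [Module.Finite R M] {x : R}
    (hx : x ∈ maximalIdeal R) (reg : IsSMulRegular M x) {P : Ideal R}
    (hP : P ∈ associatedPrimes R M) :
    ∃ Q ∈ associatedPrimes R (QuotSMulTop x M), P < Q ∧ x ∈ Q := by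
  obtain ⟨hPp, m, hm⟩ := isAssociatedPrime_iff.mp hP
  have hmem : ∀ r, r ∈ P ↔ r • m = 0 := fun r ↦ by
    rw [hm, Submodule.mem_colon_singleton, Submodule.mem_bot]
  have hm0 : m ≠ 0 := by
    rintro rfl
    exact hPp.ne_top ((Ideal.eq_top_iff_one _).mpr ((hmem 1).mpr (by simp)))
  have hxP : x ∉ P := fun h ↦ hm0 (reg.right_eq_zero_of_smul ((hmem x).mp h))
  let N : Submodule R M := Submodule.torsionBySet R M (P : Set R)
  have hN : ¬ N ≤ x • (⊤ : Submodule R M) := by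
    intro hle
    have hNx : N ≤ x • N := by
      intro y hy
      obtain ⟨z, -, rfl⟩ := (Submodule.mem_smul_pointwise_iff_exists _ _ _).mp (hle hy)
      refine Submodule.smul_mem_pointwise_smul _ _ _ ?_
      rw [Submodule.mem_torsionBySet_iff] at hy ⊢
      intro a
      apply reg.right_eq_zero_of_smul
      rw [smul_comm]
      exact hy a
    have hbot : N = ⊥ := by
      refine Submodule.eq_bot_of_le_smul_of_le_jacobson_bot (Ideal.span {x}) N
        (IsNoetherian.noetherian _) ?_ ?_
      · rwa [Submodule.ideal_span_singleton_smul]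
      · rw [Ideal.span_singleton_le_iff_mem]
        exact maximalIdeal_le_jacobson _ hx
    have : m ∈ N := by
      rw [Submodule.mem_torsionBySet_iff]
      exact fun a ↦ (hmem a).mp a.2
    rw [hbot] at this
    exact hm0 this
  obtain ⟨y, hyN, hy⟩ := SetLike.not_le_iff_exists.mp hN
  have hy0 : (Submodule.Quotient.mk y : QuotSMulTop x M) ≠ 0 := by
    rwa [Ne, Submodule.Quotient.mk_eq_zero]
  obtain ⟨Q, hQ, hle⟩ := exists_le_isAssociatedPrime_of_isNoetherianRing R _ hy0
  have key : ∀ r : R, r • y ∈ x • (⊤ : Submodule R M) → r ∈ Q := fun r hr ↦ by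
    apply hle
    rw [Submodule.mem_colon_singleton, Submodule.mem_bot, ← Submodule.Quotient.mk_smul,
      Submodule.Quotient.mk_eq_zero]
    exact hr
  have hxQ : x ∈ Q := key x (Submodule.smul_mem_pointwise_smul _ _ _ trivial)
  refine ⟨Q, hQ, lt_of_le_of_ne ?_ ?_, hxQ⟩
  · intro r hr
    apply key
    rw [(Submodule.mem_torsionBySet_iff _ _).mp hyN ⟨r, hr⟩]
    exact zero_mem _
  · rintro rfl
    exact hxP hxQ

/-- The depth of a module is at most the dimension of each of its associated primes. -/
lemma length_le_ringKrullDim_quotient_of_mem_associatedPrimes {R M : Type} [CommRing R]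
    [IsLocalRing R] [IsNoetherianRing R] [AddCommGroup M] [Module R M] [Module.Finite R M]
    {rs : List R} (hrs : ∀ r ∈ rs, r ∈ maximalIdeal R) (reg : IsRegular M rs) {P : Ideal R}
    (hP : P ∈ associatedPrimes R M) :
    (rs.length : WithBot ℕ∞) ≤ ringKrullDim (R ⧸ P) := by
  induction rs generalizing M P with
  | nil =>
    have := Ideal.Quotient.nontrivial_iff.mpr hP.isPrime.ne_top
    simpa using ringKrullDim_nonneg_of_nontrivial
  | cons x xs ih =>
    rw [isRegular_cons_iff] at reg
    simp only [List.mem_cons, forall_eq_or_imp] at hrs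
    obtain ⟨Q, hQ, hPQ, hxQ⟩ := exists_lt_mem_associatedPrimes_quotSMulTop hrs.1 reg.1 hP
    obtain ⟨y, hyQ, hyP⟩ := SetLike.exists_of_lt hPQ
    have := hP.isPrime
    have hle := ringKrullDim_quotient_succ_le_of_nonZeroDivisor (R := R ⧸ P)
      (r := Ideal.Quotient.mk P y) (mem_nonZeroDivisors_of_ne_zero
        (by rwa [Ne, Ideal.Quotient.eq_zero_iff_mem]))
    let φ : (R ⧸ P) ⧸ Ideal.span {Ideal.Quotient.mk P y} →+* R ⧸ Q :=
      Ideal.Quotient.lift _ (Ideal.Quotient.factor hPQ.le) (by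
        intro a ha
        have : Ideal.span {Ideal.Quotient.mk P y} ≤
            RingHom.ker (Ideal.Quotient.factor hPQ.le) := by
          rw [Ideal.span_singleton_le_iff_mem, RingHom.mem_ker, Ideal.Quotient.factor_mk,
            Ideal.Quotient.eq_zero_iff_mem]
          exact hyQ
        exact this ha)
    have hφ : Function.Surjective φ :=
      Ideal.Quotient.lift_surjective_of_surjective _ _ (Ideal.Quotient.factor_surjective hPQ.le)
    calc ((xs.length + 1 : ℕ) : WithBot ℕ∞) = xs.length + 1 := by push_cast; rfl
      _ ≤ ringKrullDim (R ⧸ Q) + 1 := by gcongr; exact ih hrs.2 reg.2 hQ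
      _ ≤ _ + 1 := by gcongr; exact ringKrullDim_le_of_surjective φ hφ
      _ ≤ _ := hle

/-- Dividing by a regular element of the maximal ideal lowers the depth by at most one. -/
lemma exists_isRegular_quotSMulTop {R M : Type} [CommRing R]
    [IsLocalRing R] [IsNoetherianRing R] [AddCommGroup M] [Module R M] [Module.Finite R M]
    {n : ℕ} {rs : List R} (hrs : ∀ r ∈ rs, r ∈ maximalIdeal R) (reg : IsRegular M rs)
    (hlen : rs.length = n + 1) {x : R} (hx : x ∈ maximalIdeal R) (hreg : IsSMulRegular M x) :
    ∃ rs' : List R, rs'.length = n ∧ (∀ r ∈ rs', r ∈ maximalIdeal R) ∧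
      IsRegular (QuotSMulTop x M) rs' := by
  have := reg.nontrivial
  have hlt (M' : Type) [AddCommGroup M'] [Module R M'] [Module.Finite R M'] [Nontrivial M'] :
      maximalIdeal R • (⊤ : Submodule R M') < ⊤ :=
    lt_top_iff_ne_top.mpr
      (Submodule.top_ne_ideal_smul_of_le_jacobson_annihilator (maximalIdeal_le_jacobson _)).symm
  have hntr : Nontrivial (QuotSMulTop x M) := nontrivial_quotSMulTop_of_mem_maximalIdeal M hx
  have iff₀ := (ModuleCat.exists_isRegular_tfae (maximalIdeal R) (n + 1) (ModuleCat.of R M)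
    (hlt M)).out 1 3
  have ext0 := iff₀.mpr ⟨rs, hlen, hrs, reg⟩
  have iff := (ModuleCat.exists_isRegular_tfae (maximalIdeal R) n
    (ModuleCat.of R (QuotSMulTop x M)) (hlt _)).out 1 3
  refine iff.mp fun i hi ↦ ?_
  have zero1 := AddCommGrpCat.isZero_of_iff_subsingleton.mpr (ext0 i (by omega))
  have zero2 := AddCommGrpCat.isZero_of_iff_subsingleton.mpr (ext0 (i + 1) (by omega))
  exact AddCommGrpCat.subsingleton_of_isZero <| ShortComplex.Exact.isZero_of_both_zeros
    ((Ext.covariant_sequence_exact₃' _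
      (IsSMulRegular.smulShortComplex_shortExact (M := ModuleCat.of R M) hreg)) i (i + 1) rfl)
    (zero1.eq_zero_of_src _) (zero2.eq_zero_of_tgt _)

/-- A system of parameters of a module of maximal depth is a regular sequence. -/
lemma isWeaklyRegular_of_isRegular_of_maximalIdeal_le {R M : Type} [CommRing R]
    [IsLocalRing R] [IsNoetherianRing R] [AddCommGroup M] [Module R M] [Module.Finite R M]
    {rs fs : List R} (hrs : ∀ r ∈ rs, r ∈ maximalIdeal R) (reg : IsRegular M rs)
    (hlen : rs.length = fs.length) (hfs : ∀ r ∈ fs, r ∈ maximalIdeal R)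
    (hrad : ∀ Q : Ideal R, Q.IsPrime → Module.annihilator R M ≤ Q → (∀ r ∈ fs, r ∈ Q) →
      maximalIdeal R ≤ Q) :
    IsWeaklyRegular M fs := by
  induction fs generalizing M rs with
  | nil => exact .nil R M
  | cons x xs ih =>
    simp only [List.mem_cons, forall_eq_or_imp] at hfs
    have hx : IsSMulRegular M x := by
      by_contra hx
      have hx' : x ∈ ⋃ p ∈ associatedPrimes R M, (p : Set R) := by
        rw [biUnion_associatedPrimes_eq_compl_regular]
        exact hx
      simp only [Set.mem_iUnion, exists_prop] at hx'
      obtain ⟨P, hP, hxP⟩ := hx'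
      have hPp := hP.isPrime
      have h1 := length_le_ringKrullDim_quotient_of_mem_associatedPrimes hrs reg hP
      let π := Ideal.Quotient.mk P
      have : IsLocalRing (R ⧸ P) :=
        IsLocalRing.of_surjective' π Ideal.Quotient.mk_surjective
      have hmin : maximalIdeal (R ⧸ P) ∈ (Ideal.span {y | y ∈ xs.map π}).minimalPrimes := by
        refine ⟨⟨inferInstance, Ideal.span_le.mpr ?_⟩, ?_⟩
        · intro y hy
          obtain ⟨z, hz, rfl⟩ := List.mem_map.mp hy
          have hcomap : (maximalIdeal (R ⧸ P)).comap π = maximalIdeal R :=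
            eq_maximalIdeal (Ideal.comap_isMaximal_of_surjective π Ideal.Quotient.mk_surjective)
          exact Ideal.mem_comap.mp (hcomap.symm ▸ hfs.2 z hz)
        · rintro Q ⟨hQ, hQx⟩ -
          have hmQ : maximalIdeal R ≤ Q.comap π := by
            refine hrad _ (hQ.comap π) ?_ ?_
            · rw [← Submodule.annihilator_top]
              refine hP.annihilator_le.trans fun r hr ↦ ?_
              rw [Ideal.mem_comap, Ideal.Quotient.eq_zero_iff_mem.mpr hr]
              exact zero_mem _
            · simp only [List.mem_cons, forall_eq_or_imp]
              constructor
              · rw [Ideal.mem_comap, Ideal.Quotient.eq_zero_iff_mem.mpr hxP]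
                exact zero_mem _
              · exact fun r hr ↦ hQx (Ideal.subset_span (List.mem_map_of_mem hr))
          intro y hy
          obtain ⟨z, rfl⟩ := Ideal.Quotient.mk_surjective y
          refine hmQ ((mem_maximalIdeal _).mpr fun hz ↦ hy (hz.map π))
      have h2 := Ideal.height_le_card_of_mem_minimalPrimes_span (List.finite_toSet _) hmin
      have h3 : Set.ncard {y | y ∈ xs.map π} ≤ xs.length := by
        classical
        have : {y | y ∈ xs.map π} = ((xs.map π).toFinset : Set (R ⧸ P)) := by
          ext; simp
        rw [this, Set.ncard_coe_finset]
        exact (List.toFinset_card_le _).trans (by simp)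
      rw [← maximalIdeal_height_eq_ringKrullDim, hlen] at h1
      have h4 : ((xs.length + 1 : ℕ) : ℕ∞) ≤ (xs.length : ℕ) := by
        refine (WithBot.coe_le_coe.mp h1).trans (h2.trans ?_)
        exact_mod_cast h3
      have := Nat.cast_le.mp h4
      omega
    obtain ⟨rs', hlen', hmem', reg'⟩ := exists_isRegular_quotSMulTop hrs reg hlen hfs.1 hx
    refine (isWeaklyRegular_cons_iff M x xs).mpr ⟨hx, ih hmem' reg' hlen' hfs.2 ?_⟩
    intro Q hQ hann hQx
    refine hrad Q hQ ?_ ?_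
    · exact ((Submodule.mkQ (x • (⊤ : Submodule R M))).annihilator_le_of_surjective
        (Submodule.mkQ_surjective _)).trans hann
    · simp only [List.mem_cons, forall_eq_or_imp]
      refine ⟨hann ?_, hQx⟩
      rw [Module.mem_annihilator]
      intro y
      obtain ⟨z, rfl⟩ := Submodule.Quotient.mk_surjective _ y
      rw [← Submodule.Quotient.mk_smul, Submodule.Quotient.mk_eq_zero]
      exact Submodule.smul_mem_pointwise_smul _ _ _ trivial

end

section

open IsLocalRing RingTheory.Sequence

/-- Distinct variables form a weakly regular sequence. -/
lemma isWeaklyRegular_map_X (k : Type) [Field k] {σ : Type} {l : List σ} (hl : l.Nodup) :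
    IsWeaklyRegular (MvPolynomial σ k) (l.map (X : σ → MvPolynomial σ k)) := by
  refine ⟨fun i hi ↦ ?_⟩
  rw [isSMulRegular_quotient_iff_mem_of_smul_mem]
  have hspan : (Ideal.ofList ((l.map (X : σ → MvPolynomial σ k)).take i) •
      ⊤ : Submodule (MvPolynomial σ k) (MvPolynomial σ k)) =
      Ideal.span (X '' {j | j ∈ l.take i}) := by
    rw [smul_eq_mul, Ideal.mul_top, ← List.map_take]
    exact congrArg Ideal.span (Set.ext fun y ↦ List.mem_map)
  rw [hspan]
  intro p hp
  rw [List.length_map] at hi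
  rw [List.getElem_map, smul_eq_mul, mul_comm, mem_ideal_span_X_image] at hp
  rw [mem_ideal_span_X_image]
  intro m hm
  obtain ⟨j, hj, hjm⟩ := hp (m + Finsupp.single l[i] 1) (by
    rw [mem_support_iff, coeff_mul_X]
    exact mem_support_iff.mp hm)
  refine ⟨j, hj, ?_⟩
  have hne : l[i] ≠ j := by
    rintro rfl
    obtain ⟨i', hi', h⟩ := List.mem_take_iff_getElem.mp hj
    have := (List.Nodup.getElem_inj_iff hl).mp h
    omega
  simpa [Finsupp.single_eq_of_ne hne.symm] using hjm

/-- An ideal generated by homogeneous polynomials contains the components of its elements. -/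
lemma homogeneousComponent_mem_ofList {k σ : Type} [Field k] {fs : List (MvPolynomial σ k)}
    (hom : ∀ f ∈ fs, ∃ d, f.IsHomogeneous d) {p : MvPolynomial σ k} (hp : p ∈ Ideal.ofList fs)
    (d : ℕ) : homogeneousComponent d p ∈ Ideal.ofList fs := by
  let _ := MvPolynomial.gradedAlgebra (σ := σ) (R := k)
  exact homogeneousComponent_mem_of_mem
    (Ideal.homogeneous_span _ _ fun f hf ↦ hom f hf) hp d

lemma homogeneousComponent_add_mul {k σ : Type} [Field k] {p q : MvPolynomial σ k} {d : ℕ}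
    (hq : q.IsHomogeneous d) (e : ℕ) :
    homogeneousComponent (e + d) (p * q) = homogeneousComponent e p * q := by
  let _ := MvPolynomial.gradedAlgebra (σ := σ) (R := k)
  have := DirectSum.coe_decompose_mul_add_of_right_mem (homogeneousSubmodule σ k) (i := e) (a := p)
    ((mem_homogeneousSubmodule d q).mpr hq)
  rw [← decomposition.decompose'_apply, ← decomposition.decompose'_apply]
  exact this

/-- A sequence of homogeneous polynomials that is weakly regular after localizing at the
irrelevant ideal is weakly regular. -/
lemma isWeaklyRegular_of_isWeaklyRegular_localization {k σ : Type} [Field k]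
    {fs : List (MvPolynomial σ k)} (hom : ∀ f ∈ fs, ∃ d, f.IsHomogeneous d)
    (m : Ideal (MvPolynomial σ k)) [m.IsPrime]
    (hm : m = RingHom.ker (constantCoeff : MvPolynomial σ k →+* k))
    (hreg : IsWeaklyRegular (Localization.AtPrime m)
      (fs.map (algebraMap (MvPolynomial σ k) (Localization.AtPrime m)))) :
    IsWeaklyRegular (MvPolynomial σ k) fs := by
  refine ⟨fun i hi ↦ ?_⟩
  have hreg' := hreg.regular_mod_prev i (by simpa using hi)
  rw [isSMulRegular_quotient_iff_mem_of_smul_mem, smul_eq_mul, Ideal.mul_top] at hreg' ⊢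
  rw [← List.map_take, ← Ideal.map_ofList, List.getElem_map] at hreg'
  have homi : ∀ f ∈ fs.take i, ∃ d, f.IsHomogeneous d := fun f hf ↦ hom f (List.mem_of_mem_take hf)
  obtain ⟨e, he⟩ := hom fs[i] (List.getElem_mem hi)
  intro r hr
  rw [← sum_homogeneousComponent r]
  refine sum_mem fun d _ ↦ ?_
  have h1 : homogeneousComponent d r * fs[i] ∈ Ideal.ofList (fs.take i) := by
    rw [← homogeneousComponent_add_mul he, mul_comm]
    exact homogeneousComponent_mem_ofList homi hr _
  have h2 := hreg' (algebraMap _ _ (homogeneousComponent d r)) (by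
    rw [smul_eq_mul, mul_comm, ← map_mul]
    exact Ideal.mem_map_of_mem _ h1)
  obtain ⟨s, hs, hsr⟩ := (IsLocalization.algebraMap_mem_map_algebraMap_iff m.primeCompl _ _ _).mp h2
  have h3 := homogeneousComponent_mem_ofList homi hsr (0 + d)
  rw [homogeneousComponent_add_mul (homogeneousComponent_isHomogeneous d r),
    homogeneousComponent_zero] at h3
  have hs0 : coeff 0 s ≠ 0 := by
    intro h
    apply hs
    simpa [hm, RingHom.mem_ker, constantCoeff_eq] using h
  have h4 := Ideal.mul_mem_left _ (C (coeff 0 s)⁻¹) h3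
  rwa [← mul_assoc, ← C_mul, inv_mul_cancel₀ hs0, C_1, one_mul] at h4

/-- As many homogeneous polynomials as there are variables form a regular sequence if their only
common zero is the origin. -/
lemma isRegular_of_isHomogeneous {k : Type} [Field k] {n : ℕ}
    {fs : List (MvPolynomial (Fin n) k)} (hlen : fs.length = n)
    (hom : ∀ f ∈ fs, ∃ d, f.IsHomogeneous d) (hconst : ∀ f ∈ fs, constantCoeff f = 0)
    (hprim : ∀ Q : Ideal (MvPolynomial (Fin n) k), Q.IsPrime → (∀ f ∈ fs, f ∈ Q) →
      Q ≤ RingHom.ker (constantCoeff : MvPolynomial (Fin n) k →+* k) →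
      RingHom.ker (constantCoeff : MvPolynomial (Fin n) k →+* k) ≤ Q) :
    IsRegular (MvPolynomial (Fin n) k) fs := by
  obtain ⟨m, hm⟩ : ∃ m, m = RingHom.ker (constantCoeff : MvPolynomial (Fin n) k →+* k) := ⟨_, rfl⟩
  have hmp : m.IsPrime := hm ▸ RingHom.ker_isPrime _
  have hmem : ∀ p, p ∈ m ↔ constantCoeff p = 0 := fun p ↦ by rw [hm, RingHom.mem_ker]
  rw [← hm] at hprim
  let S := Localization.AtPrime m
  have hX := (isWeaklyRegular_map_X k (List.nodup_finRange n)).isRegular_of_isLocalization_of_mem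
    S m (fun r hr ↦ by
      obtain ⟨i, -, rfl⟩ := List.mem_map.mp hr
      simp [hmem])
  have hmax : ∀ r ∈ m, algebraMap _ S r ∈ maximalIdeal S := fun r hr ↦
    (IsLocalization.AtPrime.to_map_mem_maximal_iff S m r).mpr hr
  refine ⟨isWeaklyRegular_of_isWeaklyRegular_localization hom m hm
    (isWeaklyRegular_of_isRegular_of_maximalIdeal_le ?_ hX (by simp [hlen]) ?_ ?_), ?_⟩
  · intro r hr
    simp only [List.map_map, List.mem_map] at hr
    obtain ⟨i, -, rfl⟩ := hr
    exact hmax _ (by simp [hmem])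
  · intro r hr
    obtain ⟨f, hf, rfl⟩ := List.mem_map.mp hr
    exact hmax _ ((hmem f).mpr (hconst f hf))
  · intro Q hQ _ hfQ
    have h1 := hprim (Q.comap (algebraMap _ S)) (hQ.comap _)
      (fun f hf ↦ hfQ _ (List.mem_map_of_mem hf)) (fun r hr ↦ by
        rw [← IsLocalization.AtPrime.to_map_mem_maximal_iff S m]
        exact le_maximalIdeal hQ.ne_top hr)
    rw [← Localization.AtPrime.map_eq_maximalIdeal]
    exact Ideal.map_le_iff_le_comap.mpr h1
  · rw [smul_eq_mul, Ideal.mul_top]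
    refine fun h ↦ hmp.ne_top (top_le_iff.mp (h.trans_le (Ideal.span_le.mpr fun f hf ↦ ?_)))
    exact (hmem f).mpr (hconst f hf)

end

/-- The determinant of every square submatrix lies in the ideal of minors. -/
lemma det_submatrix_mem_minorsIdeal {S : Type} [CommRing S] {p q m : ℕ}
    (A : Matrix (Fin p) (Fin q) S) (f : Fin m → Fin p) (hf : StrictMono f) (g : Fin m → Fin q) :
    (A.submatrix f g).det ∈ minorsIdeal m A := by
  by_cases hg : Function.Injective g
  · have hmono : StrictMono (g ∘ Tuple.sort g) :=
      (Tuple.monotone_sort g).strictMono_of_injective (hg.comp (Tuple.sort g).injective)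
    have hmem : (A.submatrix f (g ∘ Tuple.sort g)).det ∈ minorsIdeal m A :=
      Ideal.subset_span ⟨f, _, hf, hmono, rfl⟩
    have hdet : (A.submatrix f (g ∘ Tuple.sort g)).det =
        (Equiv.Perm.sign (Tuple.sort g) : ℤ) * (A.submatrix f g).det := by
      rw [← Matrix.det_permute' (Tuple.sort g) (A.submatrix f g)]
      rfl
    rw [hdet] at hmem
    rcases Int.units_eq_one_or (Equiv.Perm.sign (Tuple.sort g)) with h | h
    · simpa [h] using hmem
    · simpa [h] using hmem
  · simp only [Function.Injective, not_forall] at hg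
    obtain ⟨i, j, hij, hne⟩ := hg
    rw [Matrix.det_zero_of_column_eq hne fun l ↦ by simp [hij]]
    exact zero_mem _

/-- If some `s × s` minor of a matrix with `s + 1` rows is a unit, then the maximal minors
bordering it generate the ideal of maximal minors. -/
lemma minorsIdeal_le_span_bordered {S : Type} [CommRing S] {s q : ℕ}
    (A : Matrix (Fin (s + 1)) (Fin q) S) (f : Fin s → Fin (s + 1)) (hf : StrictMono f)
    (g : Fin s → Fin q) (hunit : IsUnit (A.submatrix f g).det) :
    minorsIdeal (s + 1) A ≤ Ideal.span
      (Set.range fun j ↦ (A.submatrix id (Fin.cons j g : Fin (s + 1) → Fin q)).det) := by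
  obtain ⟨i₀, hi₀⟩ : ∃ i₀, i₀ ∉ Set.range f := by
    by_contra! h
    have := Fintype.card_le_of_surjective f fun y ↦ h y
    simp at this
  have hfi : f = i₀.succAbove := by
    refine (hf.range_inj (Fin.strictMono_succAbove i₀)).mp ?_
    rw [Fin.range_succAbove]
    refine Set.eq_of_subset_of_ncard_le (fun x hx h ↦ hi₀ (h ▸ hx)) ?_
    rw [Set.ncard_compl, ← Set.image_univ, Set.ncard_image_of_injective _ hf.injective]
    simp
  subst hfi
  let v : Fin (s + 1) → S := fun i ↦ (-1) ^ (i : ℕ) * (A.submatrix i.succAbove g).det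
  have hF : ∀ j, (A.submatrix id (Fin.cons j g : Fin (s + 1) → Fin q)).det =
      ∑ i, v i * A i j := by
    intro j
    rw [Matrix.det_succ_column_zero]
    refine Finset.sum_congr rfl fun i _ ↦ ?_
    have : (A.submatrix id (Fin.cons j g : Fin (s + 1) → Fin q)).submatrix i.succAbove Fin.succ =
        A.submatrix i.succAbove g := by
      ext a b
      simp
    rw [this]
    simp only [Matrix.submatrix_apply, id, Fin.cons_zero, v]
    ring
  refine Ideal.span_le.mpr ?_
  rintro _ ⟨f', g', hf', -, rfl⟩
  have hf'id : f' = id := by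
    refine (hf'.range_inj strictMono_id).mp ?_
    rw [Set.range_id, (Finite.injective_iff_surjective.mp hf'.injective).range_eq]
  subst hf'id
  let B := A.submatrix id g'
  have hv : IsUnit (v i₀) := ((isUnit_one.neg).pow _).mul hunit
  have key : v i₀ * B.det = ∑ l, (∑ i, v i * A i (g' l)) * B.adjugate l i₀ := by
    have h : Matrix.vecMul (Matrix.vecMul v B) B.adjugate = B.det • v := by
      rw [Matrix.vecMul_vecMul, Matrix.mul_adjugate, Matrix.vecMul_smul, Matrix.vecMul_one]
    have h' := congrFun h i₀
    rw [Pi.smul_apply, smul_eq_mul, mul_comm] at h'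
    rw [← h']
    rfl
  rw [SetLike.mem_coe, ← Ideal.unit_mul_mem_iff_mem _ hv, key]
  refine sum_mem fun l _ ↦ Ideal.mul_mem_right _ _ ?_
  rw [← hF]
  exact Ideal.subset_span ⟨g' l, rfl⟩

/-- The square submatrices of a homogeneous matrix have homogeneous determinants. -/
lemma IsHomogMat.exists_isHomogeneous_det {S : Type} [CommRing S] {n p q m : ℕ} {b : Fin p → ℤ}
    {a : Fin q → ℤ} {A : Matrix (Fin p) (Fin q) (MvPolynomial (Fin (n + 1)) S)}
    (hA : IsHomogMat b a A) (f : Fin m → Fin p) (g : Fin m → Fin q) :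
    ∃ d, (A.submatrix f g).det.IsHomogeneous d := by
  refine ⟨(∑ i, a (g i) - ∑ i, b (f i)).toNat, ?_⟩
  rw [Matrix.det_apply]
  refine IsHomogeneous.sum _ _ _ fun σ _ ↦ ?_
  have hprod : (∏ i, A.submatrix f g (σ i) i).IsHomogeneous
      (∑ i, a (g i) - ∑ i, b (f i)).toNat := by
    by_cases h : ∀ i, 0 ≤ a (g i) - b (f (σ i))
    · have hsum : (∑ i, a (g i) - ∑ i, b (f i)).toNat =
          ∑ i, (a (g i) - b (f (σ i))).toNat := by
        have : ∑ i, a (g i) - ∑ i, b (f i) = ((∑ i, (a (g i) - b (f (σ i))).toNat : ℕ) : ℤ) := by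
          rw [← Equiv.sum_comp σ fun i ↦ b (f i), ← Finset.sum_sub_distrib, Nat.cast_sum]
          exact Finset.sum_congr rfl fun i _ ↦ (Int.toNat_of_nonneg (h i)).symm
        rw [this, Int.toNat_natCast]
      rw [hsum]
      exact IsHomogeneous.prod _ _ _ fun i _ ↦ (hA _ _).1
    · push Not at h
      obtain ⟨i, hi⟩ := h
      rw [Finset.prod_eq_zero (Finset.mem_univ i) ((hA _ _).2 hi)]
      exact isHomogeneous_zero _ _ _
  rcases Int.units_eq_one_or (Equiv.Perm.sign σ) with h | h
  · simpa [h] using hprod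
  · simpa [h] using hprod.neg

lemma MvPolynomial.IsHomogeneous.isUnit_of_constantCoeff_ne_zero {k σ : Type} [Field k]
    {f : MvPolynomial σ k} {d : ℕ} (hf : f.IsHomogeneous d) (h : constantCoeff f ≠ 0) :
    IsUnit f := by
  have hd : d = 0 := by
    by_contra hd
    exact h (hf.coeff_eq_zero (by simpa using Ne.symm hd))
  rw [hd, ← totalDegree_zero_iff_isHomogeneous] at hf
  exact isUnit_iff_totalDegree_of_isReduced.mpr ⟨(isUnit_iff_ne_zero).mpr h, hf⟩

lemma height_le_of_mvPolynomial {k : Type} [Field k] {n : ℕ}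
    (p : PrimeSpectrum (MvPolynomial (Fin n) k)) : Order.height p ≤ n := by
  have h := Order.height_le_krullDim p
  have hd : ringKrullDim (MvPolynomial (Fin n) k) = n := by
    rw [MvPolynomial.ringKrullDim_of_isNoetherianRing, ringKrullDim_eq_zero_of_field, zero_add,
      Nat.card_fin]
  rw [ringKrullDim] at hd
  rw [hd] at h
  exact_mod_cast h

noncomputable section

/-- If `c = n + 1`, `𝒜` is a homogeneous matrix for the degree data with
`I_t(𝒜)` of codimension `c` and the ideal of submaximal minors has codimension `≥ c + 1`
(i.e. `A = R/I_t(𝒜)` is a good determinantal artinian algebra), then `I_t(𝒜)` is generated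
by a regular sequence of `c = n + 1` homogeneous polynomials, i.e. `A` is a graded artinian
complete intersection. -/
theorem statement2 (k : Type) [Field k] (n t c : ℕ)
    (ht : 2 ≤ t) (hc : 2 ≤ c) (hcn : c = n + 1)
    (b : Fin t → ℤ) (a : Fin (t + c - 1) → ℤ) (hb : Monotone b) (ha : Monotone a)
    (A : Matrix (Fin t) (Fin (t + c - 1)) (MvPolynomial (Fin (n + 1)) k))
    (hA : IsHomogMat b a A)
    (hstd : idealHeight (minorsIdeal t A) = (c : ℕ∞))
    (hgood : ((c : ℕ∞) + 1) ≤ idealHeight (minorsIdeal (t - 1) A)) :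
    ∃ f : List (MvPolynomial (Fin (n + 1)) k),
      f.length = c ∧
      (∀ g ∈ f, ∃ d : ℕ, g.IsHomogeneous d) ∧
      RingTheory.Sequence.IsRegular (MvPolynomial (Fin (n + 1)) k) f ∧
      Ideal.span {x | x ∈ f} = minorsIdeal t A := by
  subst hcn
  obtain ⟨s, rfl⟩ : ∃ s, t = s + 1 := ⟨t - 1, by omega⟩
  rw [Nat.add_sub_cancel] at hgood
  have htop : minorsIdeal s A = ⊤ := by
    by_contra h
    obtain ⟨M, hM, hle⟩ := Ideal.exists_le_maximal _ h
    have h1 : idealHeight (minorsIdeal s A) ≤ ((n + 1 : ℕ) : ℕ∞) :=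
      sInf_le_of_le ⟨⟨M, hM.isPrime⟩, hle, rfl⟩ (height_le_of_mvPolynomial _)
    have h2 := hgood.trans h1
    exact absurd h2 (by exact_mod_cast (Nat.lt_succ_self (n + 1)).not_ge)
  obtain ⟨f, g, hf, hg, hunit⟩ : ∃ (f : Fin s → Fin (s + 1)) (g : Fin s → Fin (s + 1 + (n + 1) - 1)),
      StrictMono f ∧ StrictMono g ∧ IsUnit (A.submatrix f g).det := by
    by_contra! h
    have hle : minorsIdeal s A ≤ RingHom.ker (constantCoeff (R := k) (σ := Fin (n + 1))) := by
      refine Ideal.span_le.mpr ?_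
      rintro _ ⟨f, g, hf, hg, rfl⟩
      obtain ⟨d, hd⟩ := hA.exists_isHomogeneous_det f g
      by_contra h0
      exact h f g hf hg (hd.isUnit_of_constantCoeff_ne_zero h0)
    exact (RingHom.ker_isPrime (constantCoeff (R := k) (σ := Fin (n + 1)))).ne_top
      (top_le_iff.mp (htop ▸ hle))
  let F : Fin (s + 1 + (n + 1) - 1) → MvPolynomial (Fin (n + 1)) k := fun j ↦
    (A.submatrix id (Fin.cons j g : Fin (s + 1) → Fin (s + 1 + (n + 1) - 1))).det
  let fs := ((Finset.univ.image g)ᶜ).toList.map F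
  have hspan : Ideal.span {x | x ∈ fs} = minorsIdeal (s + 1) A := by
    refine le_antisymm (Ideal.span_le.mpr fun x hx ↦ ?_)
      ((minorsIdeal_le_span_bordered A f hf g hunit).trans (Ideal.span_le.mpr ?_))
    · obtain ⟨j, -, rfl⟩ := List.mem_map.mp hx
      exact det_submatrix_mem_minorsIdeal A id strictMono_id _
    · rintro _ ⟨j, rfl⟩
      by_cases hj : j ∈ Set.range g
      · obtain ⟨l, rfl⟩ := hj
        have : (A.submatrix id (Fin.cons (g l) g : Fin (s + 1) → _)).det = 0 :=
          Matrix.det_zero_of_column_eq (Fin.succ_ne_zero l).symm fun i ↦ by simp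
        simp [this]
      · exact Ideal.subset_span (List.mem_map_of_mem (f := F) (by simpa using hj))
  have hlen : fs.length = n + 1 := by
    simp only [fs, List.length_map, Finset.length_toList, Finset.card_compl,
      Finset.card_image_of_injective _ hg.injective, Finset.card_univ, Fintype.card_fin]
    omega
  have hom : ∀ x ∈ fs, ∃ d, x.IsHomogeneous d := by
    intro x hx
    obtain ⟨j, -, rfl⟩ := List.mem_map.mp hx
    exact hA.exists_isHomogeneous_det _ _
  have hmem : ∀ Q : Ideal (MvPolynomial (Fin (n + 1)) k), (∀ x ∈ fs, x ∈ Q) →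
      minorsIdeal (s + 1) A ≤ Q := fun Q hQ ↦ hspan ▸ Ideal.span_le.mpr hQ
  refine ⟨fs, hlen, hom, isRegular_of_isHomogeneous hlen hom (fun x hx ↦ ?_) ?_, hspan⟩
  · by_contra h0
    obtain ⟨d, hd⟩ := hom x hx
    have hx' : x ∈ minorsIdeal (s + 1) A := hspan ▸ Ideal.subset_span hx
    have h1 := Ideal.eq_top_of_isUnit_mem _ hx' (hd.isUnit_of_constantCoeff_ne_zero h0)
    have h2 : idealHeight (minorsIdeal (s + 1) A) = ⊤ := by
      refine sInf_eq_top.mpr ?_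
      rintro _ ⟨p, hp, -⟩
      exact absurd (top_le_iff.mp (h1 ▸ hp)) p.2.ne_top
    exact ENat.natCast_ne_top _ (hstd.symm.trans h2)
  · intro Q hQ hfQ hle
    by_contra hnle
    let q : PrimeSpectrum (MvPolynomial (Fin (n + 1)) k) := ⟨Q, hQ⟩
    let m : PrimeSpectrum (MvPolynomial (Fin (n + 1)) k) := ⟨_, RingHom.ker_isPrime constantCoeff⟩
    have hqm : q < m := ⟨hle, hnle⟩
    have h1 : ((n + 1 : ℕ) : ℕ∞) ≤ Order.height q :=
      hstd.symm.trans_le (sInf_le ⟨q, hmem Q hfQ, rfl⟩)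
    have h2 := Order.height_strictMono hqm
      ((height_le_of_mvPolynomial q).trans_lt (ENat.natCast_lt_top _))
    exact absurd ((h1.trans_lt h2).trans_le (height_le_of_mvPolynomial m)) (lt_irrefl _)

end
end

section
/- Assume the flag condition and let 2 ≤ i ≤ c. Then the sequence 0 → Hom_R(M_i, M) → F ⊗_R M → G_i ⊗_R M → B_i ⊗_R M → 0 is exact, where: the first map is the composition of the inclusion Hom_R(M_i,M) ↪ Hom_R(F*,M) (precomposition with the canonical surjection F* ↠ M_i) with the canonical isomorphism Hom_R(F*,M) ≅ F ⊗_R M; the middle map is φ_i ⊗ id_M (equivalently, precomposition with φ_i* under the canonical isomorphisms Hom_R(F*,M) ≅ F ⊗_R M and Hom_R(G_i*,M) ≅ G_i ⊗_R M); and the last map is (G_i ↠ B_i) ⊗ id_M. -/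
open MvPolynomial

noncomputable section

/-- The polynomial ring `R = k[x₀,…,xₙ]`. -/
abbrev PolyR (k : Type) [Field k] (n : ℕ) := MvPolynomial (Fin (n + 1)) k

/-- The flag condition: for every `2 ≤ i ≤ c` the ideal of maximal minors of the matrix
`𝒜_i` of the first `t + i − 1` columns has codimension `i`. -/
def flagCond {k : Type} [Field k] {n t c : ℕ} (hc : 2 ≤ c)
    (A : Matrix (Fin t) (Fin (t + c - 1)) (PolyR k n)) : Prop :=
  ∀ i : ℕ, 2 ≤ i → ∀ _h : i ≤ c,
    idealHeight (minorsIdeal t (firstCols A (t + i - 1) (by omega))) = (i : ℕ∞)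

section CokernelSequences

open scoped TensorProduct

variable {S N : Type*} [CommRing S] [AddCommGroup N] [Module S N] {p q : ℕ}
  (C : Matrix (Fin p) (Fin q) S)

theorem injective_eval_coker :
    Function.Injective
      (fun (g : ((Fin p → S) ⧸ LinearMap.range (Matrix.mulVecLin C)) →ₗ[S] N) (i : Fin p) =>
        g (Submodule.Quotient.mk (Pi.single i 1))) := by
  intro g g' h
  refine Submodule.linearMap_qext _ (LinearMap.pi_ext' fun i => LinearMap.ext_ring ?_)
  exact congrFun h i

theorem exact_eval_coker :
    Function.Exact
      (fun (g : ((Fin p → S) ⧸ LinearMap.range (Matrix.mulVecLin C)) →ₗ[S] N) (i : Fin p) =>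
        g (Submodule.Quotient.mk (Pi.single i 1)))
      (fun (v : Fin p → N) (j : Fin q) => ∑ i, C i j • v i) := by
  intro v
  constructor
  · intro hv
    have hle : LinearMap.range (Matrix.mulVecLin C) ≤
        LinearMap.ker (Fintype.linearCombination S v) := by
      rw [LinearMap.range_le_ker_iff]
      refine LinearMap.pi_ext' fun j => LinearMap.ext_ring ?_
      simpa [Fintype.linearCombination_apply] using congrFun hv j
    refine ⟨Submodule.liftQ _ (Fintype.linearCombination S v) hle, funext fun i => ?_⟩
    exact (Submodule.liftQ_apply _ _ _).trans (by simp)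
  · rintro ⟨g, rfl⟩
    funext j
    have hcol : ∑ i, C i j • (Pi.single i 1 : Fin p → S) = C.mulVecLin (Pi.single j 1) := by
      ext i
      simp [Finset.sum_apply, Pi.single_apply]
    have hz : (Submodule.mkQ (LinearMap.range C.mulVecLin)) (C.mulVecLin (Pi.single j 1)) = 0 := by
      simp only [Submodule.mkQ_apply, Submodule.Quotient.mk_eq_zero]
      exact LinearMap.mem_range_self _ _
    have := congrArg g hz
    rw [← hcol] at this
    simpa using this

/-- The map `Sᵐ ⊗ N → Nᵐ` sending `x ⊗ y` to `(x j • y)_j`. -/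
def tensorToPi (S N : Type*) [CommRing S] [AddCommGroup N] [Module S N] (m : ℕ) :
    TensorProduct S (Fin m → S) N →ₗ[S] (Fin m → N) :=
  LinearMap.pi fun j => (TensorProduct.lid S N).toLinearMap ∘ₗ (LinearMap.proj j).rTensor N

theorem tensorToPi_tmul {m : ℕ} (x : Fin m → S) (y : N) :
    tensorToPi S N m (x ⊗ₜ[S] y) = fun j => x j • y := by
  ext j
  simp [tensorToPi]

theorem tensorToPi_rTensor_transpose (z : TensorProduct S (Fin p → S) N) :
    tensorToPi S N q ((Matrix.mulVecLin C.transpose).rTensor N z) =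
      fun j => ∑ i, C i j • tensorToPi S N p z i := by
  induction z with
  | zero => ext; simp
  | add x y hx hy =>
    ext j
    simp only [map_add, hx, hy, Pi.add_apply, smul_add, Finset.sum_add_distrib]
  | tmul x y =>
    ext j
    simp only [LinearMap.rTensor_tmul, tensorToPi_tmul, Matrix.mulVecLin_apply, Matrix.mulVec,
      dotProduct, Matrix.transpose_apply, Finset.sum_smul, mul_smul]

theorem exact_coker_transpose_tmul :
    Function.Exact
      (fun (v : Fin p → N) (j : Fin q) => ∑ i, C i j • v i)
      (fun (w : Fin q → N) => ∑ j,
        TensorProduct.tmul S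
          (Submodule.Quotient.mk (Pi.single j (1 : S)) :
            (Fin q → S) ⧸ LinearMap.range (Matrix.mulVecLin C.transpose)) (w j)) := by
  intro w
  constructor
  · intro hw
    have hex := rTensor_exact N
      (LinearMap.exact_map_mkQ_range (Matrix.mulVecLin C.transpose))
      (Submodule.mkQ_surjective _)
    obtain ⟨z, hz⟩ := (hex (∑ j, (Pi.single j (1 : S) : Fin q → S) ⊗ₜ[S] w j)).1
      (by simpa using hw)
    refine ⟨tensorToPi S N p z, ?_⟩
    have := tensorToPi_rTensor_transpose C z
    rw [hz] at this
    refine this.symm.trans ?_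
    ext j
    simp [tensorToPi_tmul, Finset.sum_apply, Pi.single_apply]
  · rintro ⟨v, rfl⟩
    have hrow (i : Fin p) : ∑ j, C i j • (Pi.single j 1 : Fin q → S) =
        C.transpose.mulVecLin (Pi.single i 1) := by
      ext j
      simp [Finset.sum_apply, Pi.single_apply]
    have hz (i : Fin p) : ∑ j, C i j • (Submodule.Quotient.mk (Pi.single j (1 : S)) :
        (Fin q → S) ⧸ LinearMap.range (Matrix.mulVecLin C.transpose)) = 0 := by
      have h0 : Submodule.mkQ (LinearMap.range C.transpose.mulVecLin)
          (C.transpose.mulVecLin (Pi.single i 1)) = 0 := by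
        simp only [Submodule.mkQ_apply, Submodule.Quotient.mk_eq_zero]
        exact LinearMap.mem_range_self _ _
      rw [← hrow] at h0
      simpa using h0
    simp only [TensorProduct.tmul_sum]
    rw [Finset.sum_comm]
    refine Finset.sum_eq_zero fun i _ => ?_
    simp only [← TensorProduct.smul_tmul, ← TensorProduct.sum_tmul, hz, TensorProduct.zero_tmul]

theorem surjective_coker_transpose_tmul :
    Function.Surjective
      (fun (w : Fin q → N) => ∑ j,
        TensorProduct.tmul S
          (Submodule.Quotient.mk (Pi.single j (1 : S)) :
            (Fin q → S) ⧸ LinearMap.range (Matrix.mulVecLin C.transpose)) (w j)) := by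
  intro z
  induction z with
  | zero => exact ⟨0, by simp⟩
  | add x y hx hy =>
    obtain ⟨u, rfl⟩ := hx
    obtain ⟨v, rfl⟩ := hy
    exact ⟨u + v, by simp [TensorProduct.tmul_add, Finset.sum_add_distrib]⟩
  | tmul x y =>
    obtain ⟨x, rfl⟩ := Submodule.mkQ_surjective _ x
    refine ⟨fun j => x j • y, ?_⟩
    simp only [← TensorProduct.smul_tmul, ← TensorProduct.sum_tmul]
    have hx : ∑ j, x j • (Pi.single j 1 : Fin q → S) = x := by
      ext j
      simp [Finset.sum_apply, Pi.single_apply]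
    congr 1
    conv_rhs => rw [← hx]
    simp

end CokernelSequences

/-- Under the flag condition, for `2 ≤ i ≤ c` the sequence
`0 → Hom_R(M_i, M) → F ⊗_R M → G_i ⊗_R M → B_i ⊗_R M → 0` is exact, where the first map is
induced by precomposition with `F* ↠ M_i` (under `Hom_R(F*,M) ≅ F ⊗ M ≅ M^t`), the middle
map is `φ_i ⊗ id_M`, and the last map is `(G_i ↠ B_i) ⊗ id_M`. -/
theorem statement4 (k : Type) [Field k] (n t c : ℕ)
    (ht : 2 ≤ t) (hc : 2 ≤ c)
    (b : Fin t → ℤ) (a : Fin (t + c - 1) → ℤ) (hb : Monotone b) (ha : Monotone a)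
    (A : Matrix (Fin t) (Fin (t + c - 1)) (PolyR k n))
    (hA : IsHomogMat b a A)
    (hflag : flagCond hc A)
    (i : ℕ) (h2 : 2 ≤ i) (hic : i ≤ c) :
    Function.Injective
      (fun (g : (((Fin t → PolyR k n) ⧸
            LinearMap.range (Matrix.mulVecLin (firstCols A (t + i - 1) (by omega))))
          →ₗ[PolyR k n]
          ((Fin t → PolyR k n) ⧸ LinearMap.range (Matrix.mulVecLin A))))
        (i' : Fin t) => g (Submodule.Quotient.mk (Pi.single i' 1))) ∧
    Function.Exact
      (fun (g : (((Fin t → PolyR k n) ⧸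
            LinearMap.range (Matrix.mulVecLin (firstCols A (t + i - 1) (by omega))))
          →ₗ[PolyR k n]
          ((Fin t → PolyR k n) ⧸ LinearMap.range (Matrix.mulVecLin A))))
        (i' : Fin t) => g (Submodule.Quotient.mk (Pi.single i' 1)))
      (fun (v : Fin t → ((Fin t → PolyR k n) ⧸ LinearMap.range (Matrix.mulVecLin A)))
        (j : Fin (t + i - 1)) => ∑ i' : Fin t, firstCols A (t + i - 1) (by omega) i' j • v i') ∧
    Function.Exact
      (fun (v : Fin t → ((Fin t → PolyR k n) ⧸ LinearMap.range (Matrix.mulVecLin A)))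
        (j : Fin (t + i - 1)) => ∑ i' : Fin t, firstCols A (t + i - 1) (by omega) i' j • v i')
      (fun (w : Fin (t + i - 1) → ((Fin t → PolyR k n) ⧸ LinearMap.range (Matrix.mulVecLin A))) =>
        ∑ j : Fin (t + i - 1),
          TensorProduct.tmul (PolyR k n)
            (Submodule.Quotient.mk (Pi.single j (1 : PolyR k n)) :
              (Fin (t + i - 1) → PolyR k n) ⧸
                LinearMap.range (Matrix.mulVecLin (firstCols A (t + i - 1) (by omega)).transpose))
            (w j)) ∧
    Function.Surjective
      (fun (w : Fin (t + i - 1) → ((Fin t → PolyR k n) ⧸ LinearMap.range (Matrix.mulVecLin A))) =>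
        ∑ j : Fin (t + i - 1),
          TensorProduct.tmul (PolyR k n)
            (Submodule.Quotient.mk (Pi.single j (1 : PolyR k n)) :
              (Fin (t + i - 1) → PolyR k n) ⧸
                LinearMap.range (Matrix.mulVecLin (firstCols A (t + i - 1) (by omega)).transpose))
            (w j)) := by
  exact ⟨injective_eval_coker _, exact_eval_coker _, exact_coker_transpose_tmul _,
    surjective_coker_transpose_tmul _⟩

end
end

section
/- Assume the flag condition and let 2 ≤ i ≤ c. Then the sequence 0 → Hom_R(B_i, F) → Hom_R(B_i, G_i) → Hom_R(B_i, B_i) → Hom_R(M_i, M_i) → 0 is exact, where the first two maps are post-composition with F → G_i and G_i ↠ B_i respectively, and the last map sends an endomorphism g of B_i to the induced endomorphism Ext^1_R(g, R) of Ext^1_R(B_i, R) ≅ M_i (the natural isomorphism M_i ≅ Ext^1_R(B_i,R) coming from dualizing the short exact sequence 0 → F → G_i → B_i → 0). -/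
open MvPolynomial

noncomputable section

section CokernelDuality

open Matrix LinearMap

variable {R : Type} [CommRing R] {p q : ℕ} (A : Matrix (Fin p) (Fin q) R)

/-- `(g₀, g₁)` lifts the endomorphism `g` of `coker Aᵀ` to the presentation
`Aᵀ : R^p → R^q`. -/
def IsPresentationLift
    (g : ((Fin q → R) ⧸ range (mulVecLin Aᵀ)) →ₗ[R] ((Fin q → R) ⧸ range (mulVecLin Aᵀ)))
    (g₀ : (Fin p → R) →ₗ[R] (Fin p → R)) (g₁ : (Fin q → R) →ₗ[R] (Fin q → R)) : Prop :=
  (range (mulVecLin Aᵀ)).mkQ ∘ₗ g₁ = g ∘ₗ (range (mulVecLin Aᵀ)).mkQ ∧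
    g₁ ∘ₗ mulVecLin Aᵀ = mulVecLin Aᵀ ∘ₗ g₀

/-- A linear map from a free module whose image lies in the range of `f` factors through `f`. -/
theorem exists_comp_eq_of_mkQ_comp_eq_zero {M N : Type} [AddCommGroup M] [Module R M]
    [AddCommGroup N] [Module R N] {r : ℕ} (f : M →ₗ[R] N) (h : (Fin r → R) →ₗ[R] N)
    (hh : (range f).mkQ ∘ₗ h = 0) : ∃ s : (Fin r → R) →ₗ[R] M, f ∘ₗ s = h := by
  have hmem : ∀ x, h x ∈ range f := fun x => by
    rw [← Submodule.Quotient.mk_eq_zero]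
    exact LinearMap.congr_fun hh x
  obtain ⟨s, hs⟩ := Module.projective_lifting_property f.rangeRestrict
    (h.codRestrict (range f) hmem) f.surjective_rangeRestrict
  refine ⟨s, LinearMap.ext fun x => ?_⟩
  exact congrArg Subtype.val (LinearMap.congr_fun hs x)

/-- Maps between cokernels lift to the free modules presenting them. -/
theorem exists_mkQ_comp_eq {N : Type} [AddCommGroup N] [Module R N] {r : ℕ} (S : Submodule R N)
    (h : (Fin r → R) →ₗ[R] N ⧸ S) : ∃ s : (Fin r → R) →ₗ[R] N, S.mkQ ∘ₗ s = h :=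
  Module.projective_lifting_property S.mkQ h S.mkQ_surjective

theorem exists_isPresentationLift
    (g : ((Fin q → R) ⧸ range (mulVecLin Aᵀ)) →ₗ[R] ((Fin q → R) ⧸ range (mulVecLin Aᵀ))) :
    ∃ g₀ g₁, IsPresentationLift A g g₀ g₁ := by
  obtain ⟨g₁, hg₁⟩ := exists_mkQ_comp_eq _ (g ∘ₗ (range (mulVecLin Aᵀ)).mkQ)
  obtain ⟨g₀, hg₀⟩ := exists_comp_eq_of_mkQ_comp_eq_zero (mulVecLin Aᵀ) (g₁ ∘ₗ mulVecLin Aᵀ) (by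
    rw [← LinearMap.comp_assoc, hg₁, LinearMap.comp_assoc, range_mkQ_comp, LinearMap.comp_zero])
  exact ⟨g₀, g₁, hg₁, hg₀.symm⟩

/-- The transpose of a linear map between finite free modules. -/
def transposeMap {r s : ℕ} (f : (Fin r → R) →ₗ[R] (Fin s → R)) : (Fin s → R) →ₗ[R] (Fin r → R) :=
  mulVecLin (toMatrix' f)ᵀ

theorem transposeMap_comp {r s u : ℕ} (f : (Fin s → R) →ₗ[R] (Fin u → R))
    (g : (Fin r → R) →ₗ[R] (Fin s → R)) :
    transposeMap (f ∘ₗ g) = transposeMap g ∘ₗ transposeMap f := by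
  simp [transposeMap, toMatrix'_comp, transpose_mul, mulVecLin_mul]

theorem transposeMap_sub {r s : ℕ} (f g : (Fin r → R) →ₗ[R] (Fin s → R)) :
    transposeMap (f - g) = transposeMap f - transposeMap g := by
  ext
  simp [transposeMap]

theorem transposeMap_mulVecLin {r s : ℕ} (B : Matrix (Fin r) (Fin s) R) :
    transposeMap (mulVecLin B) = mulVecLin Bᵀ := by
  rw [transposeMap]
  exact congrArg (fun C => mulVecLin Cᵀ) (toMatrix'_toLin' B)

theorem transposeMap_transposeMap {r s : ℕ} (f : (Fin r → R) →ₗ[R] (Fin s → R)) :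
    transposeMap (transposeMap f) = f := by
  rw [transposeMap.eq_def f, transposeMap_mulVecLin, transpose_transpose]
  exact toLin'_toMatrix' f

variable {A}

theorem IsPresentationLift.dual_comm
    {g : ((Fin q → R) ⧸ range (mulVecLin Aᵀ)) →ₗ[R] ((Fin q → R) ⧸ range (mulVecLin Aᵀ))}
    {g₀ : (Fin p → R) →ₗ[R] (Fin p → R)} {g₁ : (Fin q → R) →ₗ[R] (Fin q → R)}
    (h : IsPresentationLift A g g₀ g₁) :
    mulVecLin A ∘ₗ transposeMap g₁ = transposeMap g₀ ∘ₗ mulVecLin A := by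
  simpa only [transposeMap_comp, transposeMap_mulVecLin, transpose_transpose] using
    congrArg transposeMap h.2

theorem IsPresentationLift.sub
    {g g' : ((Fin q → R) ⧸ range (mulVecLin Aᵀ)) →ₗ[R] ((Fin q → R) ⧸ range (mulVecLin Aᵀ))}
    {g₀ g₀' : (Fin p → R) →ₗ[R] (Fin p → R)} {g₁ g₁' : (Fin q → R) →ₗ[R] (Fin q → R)}
    (h : IsPresentationLift A g g₀ g₁) (h' : IsPresentationLift A g' g₀' g₁') :
    IsPresentationLift A (g - g') (g₀ - g₀') (g₁ - g₁') := by
  constructor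
  · rw [LinearMap.comp_sub, LinearMap.sub_comp, h.1, h'.1]
  · rw [LinearMap.comp_sub, LinearMap.sub_comp, h.2, h'.2]

/-- The dual of a lift of the zero endomorphism induces zero on `coker A`. -/
theorem IsPresentationLift.mkQ_comp_transposeMap_eq_zero (hinj : Function.Injective (mulVecLin Aᵀ))
    {g₀ : (Fin p → R) →ₗ[R] (Fin p → R)} {g₁ : (Fin q → R) →ₗ[R] (Fin q → R)}
    (h : IsPresentationLift A 0 g₀ g₁) :
    (range (mulVecLin A)).mkQ ∘ₗ transposeMap g₀ = 0 := by
  obtain ⟨s, rfl⟩ := exists_comp_eq_of_mkQ_comp_eq_zero (mulVecLin Aᵀ) g₁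
    (by rw [h.1, LinearMap.zero_comp])
  have hs : s ∘ₗ mulVecLin Aᵀ = g₀ := by
    rw [← LinearMap.cancel_left hinj, ← h.2, LinearMap.comp_assoc]
  rw [← hs, transposeMap_comp, transposeMap_mulVecLin, transpose_transpose, ← LinearMap.comp_assoc,
    range_mkQ_comp, LinearMap.zero_comp]

variable (A)

/-- When `Aᵀ` is injective, dualizing lifts gives a well-defined map
`End (coker Aᵀ) → End (coker A)`. -/
theorem exists_end_coker_of_isPresentationLift (hinj : Function.Injective (mulVecLin Aᵀ))
    (g : ((Fin q → R) ⧸ range (mulVecLin Aᵀ)) →ₗ[R] ((Fin q → R) ⧸ range (mulVecLin Aᵀ))) :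
    ∃ d : ((Fin p → R) ⧸ range (mulVecLin A)) →ₗ[R] ((Fin p → R) ⧸ range (mulVecLin A)),
      ∀ g₀ g₁, IsPresentationLift A g g₀ g₁ →
        d ∘ₗ (range (mulVecLin A)).mkQ = (range (mulVecLin A)).mkQ ∘ₗ transposeMap g₀ := by
  obtain ⟨g₀, g₁, h⟩ := exists_isPresentationLift A g
  refine ⟨(range (mulVecLin A)).liftQ ((range (mulVecLin A)).mkQ ∘ₗ transposeMap g₀) ?_,
    fun g₀' g₁' h' => ?_⟩
  · rw [LinearMap.range_le_ker_iff, LinearMap.comp_assoc, ← h.dual_comm, ← LinearMap.comp_assoc,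
      range_mkQ_comp, LinearMap.zero_comp]
  · have hsub := h.sub h'
    rw [sub_self] at hsub
    have hzero := hsub.mkQ_comp_transposeMap_eq_zero hinj
    rw [transposeMap_sub, LinearMap.comp_sub, sub_eq_zero] at hzero
    rw [Submodule.liftQ_mkQ, hzero]

variable {A} in
/-- An endomorphism of `coker Aᵀ` having a lift whose dual induces zero on `coker A` factors
through the projection onto `coker Aᵀ`. -/
theorem IsPresentationLift.exists_mkQ_comp_eq
    {g : ((Fin q → R) ⧸ range (mulVecLin Aᵀ)) →ₗ[R] ((Fin q → R) ⧸ range (mulVecLin Aᵀ))}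
    {g₀ : (Fin p → R) →ₗ[R] (Fin p → R)} {g₁ : (Fin q → R) →ₗ[R] (Fin q → R)}
    (h : IsPresentationLift A g g₀ g₁) (hzero : (range (mulVecLin A)).mkQ ∘ₗ transposeMap g₀ = 0) :
    ∃ f : ((Fin q → R) ⧸ range (mulVecLin Aᵀ)) →ₗ[R] (Fin q → R),
      (range (mulVecLin Aᵀ)).mkQ ∘ₗ f = g := by
  obtain ⟨s, hs⟩ := exists_comp_eq_of_mkQ_comp_eq_zero _ _ hzero
  have hg₀ : transposeMap s ∘ₗ mulVecLin Aᵀ = g₀ := by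
    rw [← transposeMap_transposeMap g₀, ← hs, transposeMap_comp, transposeMap_mulVecLin]
  refine ⟨(range (mulVecLin Aᵀ)).liftQ (g₁ - mulVecLin Aᵀ ∘ₗ transposeMap s) ?_, ?_⟩
  · rw [LinearMap.range_le_ker_iff, LinearMap.sub_comp, h.2, LinearMap.comp_assoc, hg₀, sub_self]
  · apply Submodule.linearMap_qext
    rw [LinearMap.comp_assoc, Submodule.liftQ_mkQ, LinearMap.comp_sub, ← LinearMap.comp_assoc,
      range_mkQ_comp, LinearMap.zero_comp, sub_zero, h.1]

/-- Every endomorphism of `coker A` is induced by the dual of a lift of an endomorphism of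
`coker Aᵀ`. -/
theorem exists_isPresentationLift_of_end_coker
    (d : ((Fin p → R) ⧸ range (mulVecLin A)) →ₗ[R] ((Fin p → R) ⧸ range (mulVecLin A))) :
    ∃ g g₀ g₁, IsPresentationLift A g g₀ g₁ ∧
      d ∘ₗ (range (mulVecLin A)).mkQ = (range (mulVecLin A)).mkQ ∘ₗ transposeMap g₀ := by
  obtain ⟨u₀, hu₀⟩ := exists_mkQ_comp_eq _ (d ∘ₗ (range (mulVecLin A)).mkQ)
  obtain ⟨u₁, hu₁⟩ := exists_comp_eq_of_mkQ_comp_eq_zero (mulVecLin A) (u₀ ∘ₗ mulVecLin A) (by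
    rw [← LinearMap.comp_assoc, hu₀, LinearMap.comp_assoc, range_mkQ_comp, LinearMap.comp_zero])
  have hcomm : transposeMap u₁ ∘ₗ mulVecLin Aᵀ = mulVecLin Aᵀ ∘ₗ transposeMap u₀ := by
    simpa only [transposeMap_comp, transposeMap_mulVecLin] using congrArg transposeMap hu₁
  refine ⟨(range (mulVecLin Aᵀ)).liftQ ((range (mulVecLin Aᵀ)).mkQ ∘ₗ transposeMap u₁) ?_,
    transposeMap u₀, transposeMap u₁, ⟨(Submodule.liftQ_mkQ _ _ _).symm, hcomm⟩, ?_⟩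
  · rw [LinearMap.range_le_ker_iff, LinearMap.comp_assoc, hcomm, ← LinearMap.comp_assoc,
      range_mkQ_comp, LinearMap.zero_comp]
  · rw [transposeMap_transposeMap, hu₀]

end CokernelDuality

/-- An ideal of nonzero height in a domain is nonzero. -/
theorem ne_bot_of_idealHeight_ne_zero {S : Type} [CommRing S] [IsDomain S] {I : Ideal S}
    (h : idealHeight I ≠ 0) : I ≠ ⊥ := by
  rintro rfl
  refine h (le_antisymm (sInf_le ⟨⊥, bot_le, ?_⟩) zero_le)
  exact (Order.height_bot _).symm

/-- If the ideal of maximal minors of `A` over a domain is nonzero, then `Aᵀ` is injective. -/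
theorem mulVecLin_transpose_injective_of_minorsIdeal_ne_bot {S : Type} [CommRing S] [IsDomain S]
    {p q : ℕ} (A : Matrix (Fin p) (Fin q) S) (h : minorsIdeal p A ≠ ⊥) :
    Function.Injective (Matrix.mulVecLin A.transpose) := by
  rw [minorsIdeal, Ne, Ideal.span_eq_bot] at h
  push Not at h
  obtain ⟨_, ⟨f, g, hf, -, rfl⟩, hdet⟩ := h
  obtain rfl : f = id := hf.id_le.antisymm' hf.le_id
  rw [← LinearMap.ker_eq_bot, LinearMap.ker_eq_bot']
  intro v hv
  refine Matrix.eq_zero_of_vecMul_eq_zero hdet ?_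
  ext j
  have hj := congrFun hv (g j)
  rwa [Matrix.mulVecLin_apply, Matrix.mulVec_transpose] at hj

/-- Under the flag condition, for `2 ≤ i ≤ c` the sequence
`0 → Hom_R(B_i,F) → Hom_R(B_i,G_i) → Hom_R(B_i,B_i) → Hom_R(M_i,M_i) → 0` is exact, where
the first two maps are post-composition with `φ_i : F → G_i` and with `G_i ↠ B_i`, and the
last map `δ` sends an endomorphism `g` of `B_i` to the endomorphism `Ext¹_R(g,R)` of
`Ext¹_R(B_i,R) ≅ M_i`; concretely, `δ g` is the endomorphism of `M_i = coker(φ_i*)` induced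
by the dual `g₀*` of any lift `(g₀, g₁)` of `g` to the resolution `0 → F → G_i → B_i → 0`. -/
theorem statement5 (k : Type) [Field k] (n t c : ℕ)
    (ht : 2 ≤ t) (hc : 2 ≤ c)
    (b : Fin t → ℤ) (a : Fin (t + c - 1) → ℤ) (hb : Monotone b) (ha : Monotone a)
    (A : Matrix (Fin t) (Fin (t + c - 1)) (PolyR k n))
    (hA : IsHomogMat b a A)
    (hflag : flagCond hc A)
    (i : ℕ) (h2 : 2 ≤ i) (hic : i ≤ c) :
    ∃ δ : (((Fin (t + i - 1) → PolyR k n) ⧸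
            LinearMap.range (Matrix.mulVecLin (firstCols A (t + i - 1) (by omega)).transpose))
          →ₗ[PolyR k n]
          ((Fin (t + i - 1) → PolyR k n) ⧸
            LinearMap.range (Matrix.mulVecLin (firstCols A (t + i - 1) (by omega)).transpose)))
        → (((Fin t → PolyR k n) ⧸
            LinearMap.range (Matrix.mulVecLin (firstCols A (t + i - 1) (by omega))))
          →ₗ[PolyR k n]
          ((Fin t → PolyR k n) ⧸
            LinearMap.range (Matrix.mulVecLin (firstCols A (t + i - 1) (by omega))))),
      (∀ g g₀ g₁,
        (LinearMap.range (Matrix.mulVecLin (firstCols A (t + i - 1) (by omega)).transpose)).mkQ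
            ∘ₗ g₁ =
          g ∘ₗ (LinearMap.range
            (Matrix.mulVecLin (firstCols A (t + i - 1) (by omega)).transpose)).mkQ →
        g₁ ∘ₗ Matrix.mulVecLin (firstCols A (t + i - 1) (by omega)).transpose =
          Matrix.mulVecLin (firstCols A (t + i - 1) (by omega)).transpose ∘ₗ g₀ →
        δ g ∘ₗ (LinearMap.range (Matrix.mulVecLin (firstCols A (t + i - 1) (by omega)))).mkQ =
          (LinearMap.range (Matrix.mulVecLin (firstCols A (t + i - 1) (by omega)))).mkQ ∘ₗ
            Matrix.mulVecLin (LinearMap.toMatrix' g₀).transpose) ∧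
      Function.Injective
        (fun (g : (((Fin (t + i - 1) → PolyR k n) ⧸
              LinearMap.range (Matrix.mulVecLin (firstCols A (t + i - 1) (by omega)).transpose))
            →ₗ[PolyR k n] (Fin t → PolyR k n))) =>
          Matrix.mulVecLin (firstCols A (t + i - 1) (by omega)).transpose ∘ₗ g) ∧
      Function.Exact
        (fun (g : (((Fin (t + i - 1) → PolyR k n) ⧸
              LinearMap.range (Matrix.mulVecLin (firstCols A (t + i - 1) (by omega)).transpose))
            →ₗ[PolyR k n] (Fin t → PolyR k n))) =>
          Matrix.mulVecLin (firstCols A (t + i - 1) (by omega)).transpose ∘ₗ g)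
        (fun (g : (((Fin (t + i - 1) → PolyR k n) ⧸
              LinearMap.range (Matrix.mulVecLin (firstCols A (t + i - 1) (by omega)).transpose))
            →ₗ[PolyR k n] (Fin (t + i - 1) → PolyR k n))) =>
          (LinearMap.range
            (Matrix.mulVecLin (firstCols A (t + i - 1) (by omega)).transpose)).mkQ ∘ₗ g) ∧
      Function.Exact
        (fun (g : (((Fin (t + i - 1) → PolyR k n) ⧸
              LinearMap.range (Matrix.mulVecLin (firstCols A (t + i - 1) (by omega)).transpose))
            →ₗ[PolyR k n] (Fin (t + i - 1) → PolyR k n))) =>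
          (LinearMap.range
            (Matrix.mulVecLin (firstCols A (t + i - 1) (by omega)).transpose)).mkQ ∘ₗ g)
        δ ∧
      Function.Surjective δ := by
  have hinj := mulVecLin_transpose_injective_of_minorsIdeal_ne_bot
    (firstCols A (t + i - 1) (by omega)) (ne_bot_of_idealHeight_ne_zero (by
      rw [hflag i h2 hic]
      exact_mod_cast (by omega : i ≠ 0)))
  generalize firstCols A (t + i - 1) _ = C at hinj ⊢
  choose δ hδ using exists_end_coker_of_isPresentationLift C hinj
  refine ⟨δ, fun g g₀ g₁ h₁ h₀ => hδ g g₀ g₁ ⟨h₁, h₀⟩,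
    fun f f' hff => (LinearMap.cancel_left hinj).1 hff, fun f => ⟨fun hf => ?_, ?_⟩,
    fun g => ⟨fun hg => ?_, ?_⟩, fun d => ?_⟩
  · have hmem : ∀ x, f x ∈ LinearMap.range (Matrix.mulVecLin C.transpose) := fun x => by
      rw [← Submodule.Quotient.mk_eq_zero]
      exact LinearMap.congr_fun hf x
    refine ⟨(LinearEquiv.ofInjective _ hinj).symm.toLinearMap ∘ₗ f.codRestrict _ hmem,
      LinearMap.ext fun x => ?_⟩
    exact congrArg Subtype.val ((LinearEquiv.ofInjective _ hinj).apply_symm_apply ⟨f x, hmem x⟩)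
  · rintro ⟨f, rfl⟩
    change _ ∘ₗ (_ ∘ₗ f) = 0
    rw [← LinearMap.comp_assoc, LinearMap.range_mkQ_comp, LinearMap.zero_comp]
  · obtain ⟨g₀, g₁, h⟩ := exists_isPresentationLift C g
    exact h.exists_mkQ_comp_eq (by rw [← hδ g g₀ g₁ h, hg, LinearMap.zero_comp])
  · rintro ⟨f, rfl⟩
    apply Submodule.linearMap_qext
    rw [hδ _ 0 (f ∘ₗ (LinearMap.range (Matrix.mulVecLin C.transpose)).mkQ) ⟨rfl, by
      rw [LinearMap.comp_assoc, LinearMap.range_mkQ_comp, LinearMap.comp_zero,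
        LinearMap.comp_zero]⟩]
    simp [transposeMap]
  · obtain ⟨g, g₀, g₁, h, hd⟩ := exists_isPresentationLift_of_end_coker C d
    refine ⟨g, Submodule.linearMap_qext _ ?_⟩
    rw [hδ g g₀ g₁ h, hd]

end
end
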